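/- Let (X, μ, T) be a dynamical system with X 0-dimensional, and suppose T is of type III. Let A and B be two non-empty clopen subsets of X. Then there exist open subsets A' ⊂ A and B' ⊂ B with μ(A∖A') = μ(B∖B') = 0 and a homeomorphism S : A' → B' which belongs to the topological full groupoid [[T]]_top, i.e. S(x) = T^{a(x)}x for a function a : A' → ℤ continuous on A'. -/

import Mathlib

open MeasureTheory Topology

/-- `X` is 0-dimensional: it has a countable base of clopen sets. -/
def ZeroDimensional (X : Type*) [TopologicalSpace X] : Prop :=
  ∃ b : Set (Set X), b.Countable ∧ (∀ s ∈ b, IsClopen s) ∧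
    TopologicalSpace.IsTopologicalBasis b

/-- A dynamical system: a non-atomic Borel probability measure of full support on a
topological space together with an ergodic non-singular homeomorphism whose
Radon–Nikodym derivative `d(μ∘T)/dμ` has the continuous version `ω`. -/
structure DynSys (X : Type*) [TopologicalSpace X] [MeasurableSpace X] where
  μ : Measure X
  T : X ≃ₜ X
  ω : X → ℝ
  prob : IsProbabilityMeasure μ
  noAtoms : NoAtoms μ
  fullSupport : ∀ U : Set X, IsOpen U → U.Nonempty → 0 < μ U
  ergodic : ∀ A : Set X, MeasurableSet A → (⇑T) ⁻¹' A = A → μ A = 0 ∨ μ A = 1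
  ωCont : Continuous ω
  ωPos : ∀ x, 0 < ω x
  rnDeriv : Measure.map (⇑T.symm) μ = μ.withDensity (fun x => ENNReal.ofReal (ω x))

namespace DynSys

variable {X Y : Type*} [TopologicalSpace X] [MeasurableSpace X]
  [TopologicalSpace Y] [MeasurableSpace Y]

/-- The iterate `Tⁿ` for `n : ℤ`. -/
noncomputable def iter (D : DynSys X) (n : ℤ) (x : X) : X :=
  (D.T.toEquiv ^ n) x

/-- The Radon–Nikodym cocycle `ρ_μ(x, Tⁿx)`. -/
noncomputable def rho (D : DynSys X) (x : X) (n : ℤ) : ℝ :=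
  if 0 ≤ n then ∑ i ∈ Finset.range n.toNat, Real.log (D.ω (D.iter (i : ℤ) x))
  else - ∑ i ∈ Finset.range (-n).toNat, Real.log (D.ω (D.iter (i : ℤ) (D.iter n x)))

/-- An inessential reduction: a `T`-invariant dense `G_δ` subset of full measure. -/
def InessRed (D : DynSys X) (X' : Set X) : Prop :=
  (⇑D.T) ⁻¹' X' = X' ∧ Dense X' ∧ IsGδ X' ∧ D.μ X' = 1

/-- A set is virtually clopen if its intersection with some inessential reduction `X'`
is relatively clopen in `X'`. -/
def VirtClopen (D : DynSys X) (A : Set X) : Prop :=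
  ∃ X' : Set X, D.InessRed X' ∧ IsClopen (Subtype.val ⁻¹' A : Set X')

/-- The asymptotic range `r(ρ_μ)` of the Radon–Nikodym cocycle. -/
def asymRange (D : DynSys X) : Set ℝ :=
  {t | ∀ ε : ℝ, 0 < ε → ∀ A : Set X, MeasurableSet A → 0 < D.μ A →
    ∃ k : ℤ, k ≠ 0 ∧ ∃ B : Set X, MeasurableSet B ∧ B ⊆ A ∧ 0 < D.μ B ∧
      ∀ x ∈ B, |D.rho x k - t| < ε}

/-- The topological asymptotic range `r_top(ρ_μ)` of the Radon–Nikodym cocycle. -/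
def topAsymRange (D : DynSys X) : Set ℝ :=
  {t | ∀ ε : ℝ, 0 < ε → ∀ A : Set X, D.VirtClopen A → 0 < D.μ A →
    ∃ k : ℤ, k ≠ 0 ∧ ∃ B : Set X, B ⊆ A ∧ 0 < D.μ B ∧
      ∀ x ∈ B, |D.rho x k - t| < ε}

/-- Type `III`: there is no equivalent σ-finite `T`-invariant measure. -/
def TypeIII (D : DynSys X) : Prop :=
  ¬ ∃ ν : Measure X, SigmaFinite ν ∧ ν ≪ D.μ ∧ D.μ ≪ ν ∧ Measure.map (⇑D.T) ν = ν

/-- Almost continuous orbit equivalence of two dynamical systems. -/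
def ACOE (D : DynSys X) (E : DynSys Y) : Prop :=
  ∃ (X₀ : Set X) (Y₀ : Set Y) (φ : X → Y) (ψ : Y → X),
    D.InessRed X₀ ∧ E.InessRed Y₀ ∧
    Set.BijOn φ X₀ Y₀ ∧ ContinuousOn φ X₀ ∧ ContinuousOn ψ Y₀ ∧ Set.InvOn ψ φ X₀ Y₀ ∧
    (∀ x ∈ X₀, φ '' {z | ∃ k : ℤ, z = D.iter k x} = {w | ∃ k : ℤ, w = E.iter k (φ x)}) ∧
    (∃ f : Y → ℝ, ContinuousOn f Y₀ ∧ (∀ y ∈ Y₀, 0 < f y) ∧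
      ∀ A : Set Y, MeasurableSet A →
        D.μ (φ ⁻¹' A ∩ X₀) = ∫⁻ y in A, ENNReal.ofReal (f y) ∂E.μ) ∧
    (∃ n m : X → ℤ, ContinuousOn n X₀ ∧ ContinuousOn m X₀ ∧
      ∀ x ∈ X₀, φ (D.T x) = E.iter (n x) (φ x) ∧ E.T (φ x) = φ (D.iter (m x) x))

end DynSys

/-- An `r`-uniform subrelation of `R_T` on the clopen set `C`, with fundamental
(clopen) subset `B` and splitting homeomorphism `(i, b) ↦ h i b : I_r × B → C`,
each `h i` being given on `B` by `h i b = T^(a i b) b` with `a i` continuous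
(i.e. `h i` belongs to the topological full groupoid `[[T]]_top`);
`proj` and `idx` form the continuous inverse, `proj` being the associated projection. -/
structure UniformRel {X : Type*} [TopologicalSpace X] [MeasurableSpace X]
    (D : DynSys X) (r : ℕ) (C B : Set X) where
  rpos : 0 < r
  h : Fin r → X → X
  a : Fin r → X → ℤ
  clopenB : IsClopen B
  subB : B ⊆ C
  h_zero : ∀ b ∈ B, h ⟨0, rpos⟩ b = b
  h_eq : ∀ (i : Fin r), ∀ b ∈ B, h i b = D.iter (a i b) b
  a_cont : ∀ i : Fin r, ContinuousOn (a i) B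
  h_cont : ∀ i : Fin r, ContinuousOn (h i) B
  maps : ∀ i : Fin r, Set.MapsTo (h i) B C
  inj : ∀ (i j : Fin r), ∀ b ∈ B, ∀ b' ∈ B, h i b = h j b' → i = j ∧ b = b'
  proj : X → X
  idx : X → Fin r
  proj_cont : ContinuousOn proj C
  idx_cont : ContinuousOn idx C
  proj_mem : ∀ x ∈ C, proj x ∈ B
  h_proj : ∀ x ∈ C, h (idx x) (proj x) = x

namespace DynSys

variable {X : Type*} [TopologicalSpace X] [MeasurableSpace X] (D : DynSys X)

section Iterates

@[simp] lemma iter_zero (x : X) : D.iter 0 x = x := by simp [iter]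

lemma iter_add (m n : ℤ) (x : X) : D.iter (m + n) x = D.iter m (D.iter n x) := by
  simp [iter, zpow_add]

lemma iter_one (x : X) : D.iter 1 x = D.T x := by simp [iter]

lemma iter_add_one (n : ℤ) (x : X) : D.iter (n + 1) x = D.iter n (D.T x) := by
  rw [iter_add, iter_one]

@[simp] lemma iter_neg_iter (n : ℤ) (x : X) : D.iter (-n) (D.iter n x) = x := by
  rw [← iter_add, neg_add_cancel, iter_zero]

@[simp] lemma iter_iter_neg (n : ℤ) (x : X) : D.iter n (D.iter (-n) x) = x := by
  rw [← iter_add, add_neg_cancel, iter_zero]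

lemma continuous_iter (n : ℤ) : Continuous (D.iter n) := by
  have hsymm : ∀ x, D.iter (-1) x = D.T.symm x := fun x => by simp [iter]
  induction n with
  | zero => exact continuous_id.congr fun x => (D.iter_zero x).symm
  | succ i ih =>
    rw [show D.iter (i + 1) = D.iter i ∘ D.T from funext (D.iter_add_one i)]
    exact ih.comp D.T.continuous
  | pred i ih =>
    rw [show D.iter (-i - 1) = D.iter (-i) ∘ D.T.symm from funext fun x => by
      rw [sub_eq_add_neg, iter_add, hsymm, Function.comp_apply]]
    exact ih.comp D.T.symm.continuous

end Iterates

section Cocycle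

/-- The product `∏ i < k, ω (Tⁱ x)`. -/
noncomputable def birkhoffProd (k : ℕ) (x : X) : ℝ :=
  ∏ i ∈ Finset.range k, D.ω (D.iter (i : ℤ) x)

/-- The multiplicative Radon–Nikodym cocycle `d(μ ∘ Tⁿ)/dμ`. -/
noncomputable def deriv : ℤ → X → ℝ
  | Int.ofNat k => D.birkhoffProd k
  | Int.negSucc k => fun x => (D.birkhoffProd (k + 1) (D.iter (-(k + 1 : ℤ)) x))⁻¹

lemma birkhoffProd_pos (k : ℕ) (x : X) : 0 < D.birkhoffProd k x :=
  Finset.prod_pos fun _ _ => D.ωPos _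

lemma continuous_birkhoffProd (k : ℕ) : Continuous (D.birkhoffProd k) :=
  continuous_finsetProd _ fun i _ => D.ωCont.comp (D.continuous_iter i)

lemma continuous_deriv (n : ℤ) : Continuous (D.deriv n) := by
  cases n with
  | ofNat k => exact D.continuous_birkhoffProd k
  | negSucc k =>
    exact ((D.continuous_birkhoffProd _).comp (D.continuous_iter _)).inv₀
      fun x => (D.birkhoffProd_pos _ _).ne'

lemma deriv_zero (x : X) : D.deriv 0 x = 1 := by
  change D.birkhoffProd 0 x = 1
  simp [birkhoffProd]

lemma deriv_add_one (n : ℤ) (x : X) : D.deriv (n + 1) x = D.ω x * D.deriv n (D.T x) := by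
  cases n with
  | ofNat k =>
    change D.birkhoffProd (k + 1) x = D.ω x * D.birkhoffProd k (D.T x)
    simp only [birkhoffProd, Finset.prod_range_succ']
    simp [iter_add_one, mul_comm]
  | negSucc k =>
    have hinner : D.iter (-(k + 1 : ℤ)) (D.T x) = D.iter (-(k : ℤ)) x := by
      rw [← iter_add_one]; congr 1; ring
    have hlast : D.birkhoffProd (k + 1) (D.iter (-(k : ℤ)) x)
        = D.birkhoffProd k (D.iter (-(k : ℤ)) x) * D.ω x := by
      simp [birkhoffProd, Finset.prod_range_succ]
    have hleft : D.deriv (Int.negSucc k + 1) x = (D.birkhoffProd k (D.iter (-(k : ℤ)) x))⁻¹ := by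
      cases k with
      | zero => simp [birkhoffProd, deriv_zero]
      | succ k =>
        rw [show Int.negSucc (k + 1) + 1 = Int.negSucc k by omega]
        simp [deriv]
    rw [hleft]
    change _ = D.ω x * (D.birkhoffProd (k + 1) (D.iter (-(k + 1 : ℤ)) (D.T x)))⁻¹
    rw [hinner, hlast]
    have := (D.ωPos x).ne'
    have := (D.birkhoffProd_pos k (D.iter (-(k : ℤ)) x)).ne'
    field_simp

lemma measure_eq_one_of_invariant {E C : Set X} (hE : MeasurableSet E)
    (hinv : D.T ⁻¹' E = E) (hCE : C ⊆ E) (hC : D.μ C ≠ 0) : D.μ E = 1 :=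
  (D.ergodic E hE hinv).resolve_left fun h => hC (measure_mono_null hCE h)

variable [BorelSpace X]

lemma lintegral_comp_T {f : X → ENNReal} (hf : Measurable f) :
    ∫⁻ x, ENNReal.ofReal (D.ω x) * f (D.T x) ∂D.μ = ∫⁻ x, f x ∂D.μ := by
  have hfT : Measurable fun x => f (D.T x) := hf.comp D.T.continuous.measurable
  have hω : Measurable fun x => ENNReal.ofReal (D.ω x) := D.ωCont.measurable.ennreal_ofReal
  have h := lintegral_withDensity_eq_lintegral_mul D.μ hω hfT
  rw [← D.rnDeriv, lintegral_map hfT D.T.symm.continuous.measurable] at h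
  simpa using h.symm

lemma lintegral_comp_iter {f : X → ENNReal} (hf : Measurable f) (n : ℤ) :
    ∫⁻ x, ENNReal.ofReal (D.deriv n x) * f (D.iter n x) ∂D.μ = ∫⁻ x, f x ∂D.μ := by
  have hstep : ∀ n : ℤ, ∫⁻ x, ENNReal.ofReal (D.deriv (n + 1) x) * f (D.iter (n + 1) x) ∂D.μ
      = ∫⁻ x, ENNReal.ofReal (D.deriv n x) * f (D.iter n x) ∂D.μ := fun n => by
    rw [← D.lintegral_comp_T (f := fun x => ENNReal.ofReal (D.deriv n x) * f (D.iter n x))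
      ((D.continuous_deriv n).measurable.ennreal_ofReal.mul
        (hf.comp (D.continuous_iter n).measurable))]
    simp_rw [deriv_add_one, iter_add_one, ENNReal.ofReal_mul (D.ωPos _).le, mul_assoc]
  induction n with
  | zero => simp [deriv_zero]
  | succ i ih => rw [hstep, ih]
  | pred i ih => rw [← hstep, sub_add_cancel, ih]

lemma measure_translate_le {U : Set X} (hU : MeasurableSet U) (n : ℤ) {ε : ℝ}
    (h : ∀ x ∈ U, D.deriv n x ≤ ε) :
    D.μ (D.iter (-n) ⁻¹' U) ≤ ENNReal.ofReal ε * D.μ U := by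
  have hV : MeasurableSet (D.iter (-n) ⁻¹' U) := (D.continuous_iter _).measurable hU
  rw [← lintegral_indicator_one hV, ← lintegral_indicator_one hU,
    ← D.lintegral_comp_iter (measurable_one.indicator hV) n,
    ← lintegral_const_mul _ (measurable_one.indicator hU)]
  refine lintegral_mono fun x => ?_
  by_cases hx : x ∈ U
  · simpa [Set.indicator, hx] using ENNReal.ofReal_le_ofReal (h x hx)
  · simp [Set.indicator, hx]

/-- A positive measurable solution of `f = ω · f ∘ T` is the density of an invariant measure. -/
lemma not_typeIII_of_density {f : X → ENNReal} (hf : Measurable f)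
    (hcoc : ∀ x, f x = ENNReal.ofReal (D.ω x) * f (D.T x))
    (hpos : D.μ {x | f x ≠ 0} ≠ 0) (hfin : D.μ {x | f x ≠ ⊤} ≠ 0) : ¬ D.TypeIII := by
  have := D.prob
  have hω : ∀ x, ENNReal.ofReal (D.ω x) ≠ 0 := fun x => by simpa using D.ωPos x
  have h0 : ∀ᵐ x ∂D.μ, f x ≠ 0 := by
    have hm : MeasurableSet {x | f x ≠ 0} := (hf (measurableSet_singleton 0)).compl
    refine (mem_ae_iff_prob_eq_one hm).2
      (D.measure_eq_one_of_invariant hm ?_ subset_rfl hpos)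
    ext x
    simp [hcoc x, D.ωPos x]
  have htop : ∀ᵐ x ∂D.μ, f x ≠ ⊤ := by
    have hm : MeasurableSet {x | f x ≠ ⊤} := (hf (measurableSet_singleton ⊤)).compl
    refine (mem_ae_iff_prob_eq_one hm).2
      (D.measure_eq_one_of_invariant hm ?_ subset_rfl hfin)
    ext x
    simp [hcoc x, ENNReal.mul_eq_top, D.ωPos x]
  refine not_not.2 ⟨D.μ.withDensity f, SigmaFinite.withDensity_of_ne_top htop,
    withDensity_absolutelyContinuous _ _, withDensity_absolutelyContinuous' hf.aemeasurable h0, ?_⟩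
  ext E hE
  have hTE : MeasurableSet (D.T ⁻¹' E) := D.T.continuous.measurable hE
  rw [Measure.map_apply D.T.continuous.measurable hE, withDensity_apply _ hTE,
    withDensity_apply _ hE, ← lintegral_indicator hTE, ← lintegral_indicator hE,
    ← D.lintegral_comp_T (hf.indicator hE)]
  refine lintegral_congr fun x => ?_
  by_cases hx : D.T x ∈ E
  · simp [Set.indicator, hx, ← hcoc]
  · simp [Set.indicator, hx]

/-- For a system of type `III`, the derivative takes arbitrarily small values between any two
sets of positive measure. -/
lemma exists_deriv_lt (hIII : D.TypeIII) {C E : Set X} (hE : MeasurableSet E)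
    (hC0 : D.μ C ≠ 0) (hE0 : D.μ E ≠ 0) {ε : ℝ} (hε : 0 < ε) :
    ∃ n : ℤ, ∃ x ∈ C, D.iter n x ∈ E ∧ D.deriv n x < ε := by
  classical
  by_contra! hcon
  set g : ℤ → X → ENNReal := fun n x =>
    if D.iter n x ∈ E then ENNReal.ofReal (D.deriv n x) else ⊤
  refine D.not_typeIII_of_density (f := fun x => ⨅ n, g n x) ?_ ?_ ?_ ?_ hIII
  · exact .iInf fun n => Measurable.ite ((D.continuous_iter n).measurable hE)
      (D.continuous_deriv n).measurable.ennreal_ofReal measurable_const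
  · intro x
    have hω : ENNReal.ofReal (D.ω x) ≠ 0 := by simpa using D.ωPos x
    rw [ENNReal.mul_iInf_of_ne hω ENNReal.ofReal_ne_top]
    refine ((Equiv.addRight (1 : ℤ)).iInf_congr fun n => ?_).symm
    simp only [g, Equiv.coe_addRight, deriv_add_one, iter_add_one]
    split_ifs
    · rw [ENNReal.ofReal_mul (D.ωPos x).le]
    · rw [ENNReal.mul_top hω]
  · refine fun h => hC0 (measure_mono_null (fun x hx => ?_) h)
    have hle : ENNReal.ofReal ε ≤ ⨅ n, g n x := le_iInf fun n => by
      simp only [g]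
      split_ifs with hn
      · exact ENNReal.ofReal_le_ofReal (hcon n x hx hn)
      · exact le_top
    exact ((ENNReal.ofReal_pos.2 hε).trans_le hle).ne'
  · refine fun h => hE0 (measure_mono_null (fun x hx => ?_) h)
    refine ((iInf_le (fun n => g n x) 0).trans_lt ?_).ne
    simp [g, hx]

end Cocycle

section Matched

/-- `U` and `V` are matched if `U` is the disjoint union of open sets `P n`, `n : ℤ`, such that
`V` is the disjoint union of the sets `Tⁿ (P n)`. -/
def Matched (U V : Set X) : Prop :=
  ∃ P : ℤ → Set X, (∀ n, IsOpen (P n)) ∧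
    (∀ n m x, x ∈ P n → x ∈ P m → n = m) ∧
    (∀ n m y, D.iter (-n) y ∈ P n → D.iter (-m) y ∈ P m → n = m) ∧
    (∀ x, x ∈ U ↔ ∃ n, x ∈ P n) ∧ (∀ y, y ∈ V ↔ ∃ n, D.iter (-n) y ∈ P n)

variable {D}

lemma Matched.symm {U V : Set X} (h : D.Matched U V) : D.Matched V U := by
  obtain ⟨P, ho, h1, h2, hU, hV⟩ := h
  refine ⟨fun n => D.iter n ⁻¹' P (-n), fun n => (ho _).preimage (D.continuous_iter n),
    fun n m y hn hm => ?_, fun n m x hn hm => ?_, fun y => ?_, fun x => ?_⟩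
  · exact neg_injective (h2 (-n) (-m) y (by simpa using hn) (by simpa using hm))
  · exact neg_injective (h1 (-n) (-m) x (by simpa using hn) (by simpa using hm))
  · rw [hV, ← (Equiv.neg ℤ).exists_congr_left.symm]
    simp
  · rw [hU, ← (Equiv.neg ℤ).exists_congr_left.symm]
    simp

lemma Matched.iUnion {ι : Type*} {U V : ι → Set X} (h : ∀ i, D.Matched (U i) (V i))
    (hU : Pairwise (Function.onFun Disjoint U)) (hV : Pairwise (Function.onFun Disjoint V)) :
    D.Matched (⋃ i, U i) (⋃ i, V i) := by
  choose P ho h1 h2 hPU hPV using h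
  refine ⟨fun n => ⋃ i, P i n, fun n => isOpen_iUnion fun i => ho i n, ?_, ?_, ?_, ?_⟩
  · intro n m x hn hm
    obtain ⟨i, hi⟩ := Set.mem_iUnion.1 hn
    obtain ⟨j, hj⟩ := Set.mem_iUnion.1 hm
    obtain rfl : i = j := by
      by_contra hij
      exact Set.disjoint_left.1 (hU hij) ((hPU i x).2 ⟨n, hi⟩) ((hPU j x).2 ⟨m, hj⟩)
    exact h1 i n m x hi hj
  · intro n m y hn hm
    obtain ⟨i, hi⟩ := Set.mem_iUnion.1 hn
    obtain ⟨j, hj⟩ := Set.mem_iUnion.1 hm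
    obtain rfl : i = j := by
      by_contra hij
      exact Set.disjoint_left.1 (hV hij) ((hPV i y).2 ⟨n, hi⟩) ((hPV j y).2 ⟨m, hj⟩)
    exact h2 i n m y hi hj
  · intro x
    simp only [Set.mem_iUnion, hPU]
    exact exists_comm
  · intro y
    simp only [Set.mem_iUnion, hPV]
    exact exists_comm

lemma Matched.union {U V U' V' : Set X} (h : D.Matched U V) (h' : D.Matched U' V')
    (hU : Disjoint U U') (hV : Disjoint V V') : D.Matched (U ∪ U') (V ∪ V') := by
  rw [Set.union_eq_iUnion, Set.union_eq_iUnion]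
  refine Matched.iUnion (fun b => ?_) (pairwise_disjoint_on_bool.2 hU)
    (pairwise_disjoint_on_bool.2 hV)
  cases b <;> assumption

lemma Matched.trans_diff {A A' A'' B B' B'' : Set X} (hA : A' ⊆ A) (hA' : A'' ⊆ A')
    (hB : B' ⊆ B) (hB' : B'' ⊆ B') (h : D.Matched (A \ A') (B \ B'))
    (h' : D.Matched (A' \ A'') (B' \ B'')) : D.Matched (A \ A'') (B \ B'') := by
  have hdisj : ∀ S S' S'' : Set X, Disjoint (S \ S') (S' \ S'') := fun S S' S'' =>
    Set.disjoint_left.2 fun _ hx hx' => hx.2 hx'.1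
  rw [← Set.sdiff_union_sdiff_cancel hA hA', ← Set.sdiff_union_sdiff_cancel hB hB']
  exact h.union h' (hdisj _ _ _) (hdisj _ _ _)

lemma matched_translate {U : Set X} (hU : IsOpen U) (n : ℤ) :
    D.Matched U (D.iter (-n) ⁻¹' U) := by
  refine ⟨fun m => {x | m = n ∧ x ∈ U}, fun m => ?_, ?_, ?_, ?_, ?_⟩
  · by_cases h : m = n <;> simp [h, hU]
  all_goals simp +contextual

lemma Matched.isOpen {U V : Set X} (h : D.Matched U V) : IsOpen U := by
  obtain ⟨P, ho, -, -, hU, -⟩ := h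
  rw [show U = ⋃ n, P n by ext x; simp [hU]]
  exact isOpen_iUnion ho

lemma Matched.exists_homeo {U V : Set X} (h : D.Matched U V) :
    ∃ (S S' : X → X) (a : X → ℤ), Set.BijOn S U V ∧ ContinuousOn S U ∧ ContinuousOn S' V ∧
      Set.InvOn S' S U V ∧ ContinuousOn a U ∧ ∀ x ∈ U, S x = D.iter (a x) x := by
  classical
  obtain ⟨P, ho, h1, h2, hU, hV⟩ := h
  have hex : ∀ x, ∃ n, x ∈ U → x ∈ P n := fun x => by
    by_cases hx : x ∈ U
    · obtain ⟨n, hn⟩ := (hU x).1 hx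
      exact ⟨n, fun _ => hn⟩
    · exact ⟨0, fun h => (hx h).elim⟩
  have hex' : ∀ y, ∃ n, y ∈ V → D.iter (-n) y ∈ P n := fun y => by
    by_cases hy : y ∈ V
    · obtain ⟨n, hn⟩ := (hV y).1 hy
      exact ⟨n, fun _ => hn⟩
    · exact ⟨0, fun h => (hy h).elim⟩
  choose a ha using hex
  choose c hc using hex'
  have haP : ∀ {n x}, x ∈ P n → a x = n := fun {n x} hx =>
    h1 _ _ x (ha x ((hU x).2 ⟨n, hx⟩)) hx
  have hcP : ∀ {n y}, D.iter (-n) y ∈ P n → c y = n := fun {n y} hy =>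
    h2 _ _ y (hc y ((hV y).2 ⟨n, hy⟩)) hy
  have hca : ∀ x ∈ U, c (D.iter (a x) x) = a x := fun x hx =>
    hcP (by simpa using ha x hx)
  have hac : ∀ y ∈ V, a (D.iter (-c y) y) = c y := fun y hy => haP (hc y hy)
  have hmaps : Set.MapsTo (fun x => D.iter (a x) x) U V := fun x hx =>
    (hV _).2 ⟨a x, by simpa using ha x hx⟩
  have hmaps' : Set.MapsTo (fun y => D.iter (-c y) y) V U := fun y hy =>
    (hU _).2 ⟨c y, hc y hy⟩
  have hinv : Set.InvOn (fun y => D.iter (-c y) y) (fun x => D.iter (a x) x) U V :=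
    ⟨fun x hx => by simp [hca x hx], fun y hy => by simp [hac y hy]⟩
  have haev : ∀ x ∈ U, ∀ᶠ z in 𝓝 x, a z = a x := fun x hx => by
    filter_upwards [(ho _).mem_nhds (ha x hx)] with z hz using haP hz
  have hcev : ∀ y ∈ V, ∀ᶠ z in 𝓝 y, c z = c y := fun y hy => by
    filter_upwards [((ho _).preimage (D.continuous_iter (-c y))).mem_nhds (hc y hy)]
      with z hz using hcP hz
  refine ⟨fun x => D.iter (a x) x, fun y => D.iter (-c y) y, a, hinv.bijOn hmaps hmaps',
    fun x hx => ?_, fun y hy => ?_, hinv, fun x hx => ?_, fun x _ => rfl⟩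
  · refine ((D.continuous_iter (a x)).continuousAt.congr ?_).continuousWithinAt
    filter_upwards [haev x hx] with z hz
    rw [hz]
  · refine ((D.continuous_iter (-c y)).continuousAt.congr ?_).continuousWithinAt
    filter_upwards [hcev y hy] with z hz
    rw [hz]
  · refine ((continuousAt_const (y := a x)).congr ?_).continuousWithinAt
    filter_upwards [haev x hx] with z hz using hz.symm

end Matched

section Exhaustion

/-- The part of `A ∩ W` that `Tⁿ` maps into `B`. -/
def movable (n : ℤ) (W A B : Set X) : Set X := A ∩ W ∩ D.iter n ⁻¹' B

/-- Greedy matching of `A` with `B`: at step `j` the part of what is left of `A` that lies in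
`W j` and is mapped by `T ^ n j` into what is left of `B` is removed together with its image. -/
def greedy (n : ℕ → ℤ) (W : ℕ → Set X) (A B : Set X) : ℕ → Set X × Set X
  | 0 => (A, B)
  | j + 1 =>
    ((greedy n W A B j).1 \ D.movable (n j) (W j) (greedy n W A B j).1 (greedy n W A B j).2,
      (greedy n W A B j).2 \ D.iter (-n j) ⁻¹'
        D.movable (n j) (W j) (greedy n W A B j).1 (greedy n W A B j).2)

lemma isClopen_movable {n : ℤ} {W A B : Set X} (hW : IsClopen W) (hA : IsClopen A)
    (hB : IsClopen B) : IsClopen (D.movable n W A B) :=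
  (hA.inter hW).inter (hB.preimage (D.continuous_iter n))

lemma translate_movable_subset (n : ℤ) (W A B : Set X) :
    D.iter (-n) ⁻¹' D.movable n W A B ⊆ B := fun y hy => by
  simpa using hy.2

variable {D} {n : ℕ → ℤ} {W : ℕ → Set X} {A B : Set X}

lemma greedy_fst_antitone : Antitone fun j => (D.greedy n W A B j).1 :=
  antitone_nat_of_succ_le fun _ => Set.sdiff_subset

lemma greedy_snd_antitone : Antitone fun j => (D.greedy n W A B j).2 :=
  antitone_nat_of_succ_le fun _ => Set.sdiff_subset

lemma isClopen_greedy (hW : ∀ j, IsClopen (W j)) (hA : IsClopen A) (hB : IsClopen B) (j : ℕ) :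
    IsClopen (D.greedy n W A B j).1 ∧ IsClopen (D.greedy n W A B j).2 := by
  induction j with
  | zero => exact ⟨hA, hB⟩
  | succ j ih =>
    have hU := D.isClopen_movable (n := n j) (hW j) ih.1 ih.2
    exact ⟨ih.1.diff hU, ih.2.diff (hU.preimage (D.continuous_iter _))⟩

lemma matched_greedy (hW : ∀ j, IsClopen (W j)) (hA : IsClopen A) (hB : IsClopen B) (j : ℕ) :
    D.Matched (A \ (D.greedy n W A B j).1) (B \ (D.greedy n W A B j).2) := by
  induction j with
  | zero => simpa [greedy] using matched_translate (D := D) isOpen_empty 0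
  | succ j ih =>
    obtain ⟨h1, h2⟩ := isClopen_greedy (D := D) (n := n) hW hA hB j
    refine ih.trans_diff (greedy_fst_antitone j.zero_le) (greedy_fst_antitone j.le_succ)
      (greedy_snd_antitone j.zero_le) (greedy_snd_antitone j.le_succ) ?_
    simp only [greedy]
    rw [Set.sdiff_sdiff_cancel_left (show D.movable _ _ _ _ ⊆ _ from Set.inter_subset_left.trans Set.inter_subset_left),
            Set.sdiff_sdiff_cancel_left (D.translate_movable_subset _ _ _ _)]
    exact matched_translate (D.isClopen_movable (hW j) h1 h2).isOpen _

lemma mem_greedy_fst {p : X} (hp : p ∈ A) (hpW : ∀ j, p ∉ W j) (j : ℕ) :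
    p ∈ (D.greedy n W A B j).1 := by
  induction j with
  | zero => exact hp
  | succ j ih => exact ⟨ih, fun h => hpW j h.1.2⟩

lemma not_mem_greedy {j : ℕ} {x : X} (hx : ∀ i, x ∈ (D.greedy n W A B i).1) (hxW : x ∈ W j) :
    ∃ i, D.iter (n j) x ∉ (D.greedy n W A B i).2 := by
  by_contra! h
  exact (hx (j + 1)).2 ⟨⟨hx j, hxW⟩, h j⟩

variable [BorelSpace X]

lemma measure_le_greedy_snd (hW : ∀ j, IsClopen (W j)) (hA : IsClopen A) (hB : IsClopen B)
    {ε : ℝ} (hε : ∀ j, ∀ x ∈ W j, D.deriv (n j) x ≤ ε) (j : ℕ) :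
    D.μ B ≤ D.μ (D.greedy n W A B j).2 + ENNReal.ofReal ε * D.μ (A \ (D.greedy n W A B j).1) := by
  induction j with
  | zero => simp [greedy]
  | succ j ih =>
    obtain ⟨h1, h2⟩ := isClopen_greedy (D := D) (n := n) hW hA hB j
    have hsub : (D.greedy n W A B j).1 ⊆ A := greedy_fst_antitone j.zero_le
    rw [greedy]
    generalize D.greedy n W A B j = s at ih h1 h2 hsub
    set U := D.movable (n j) (W j) s.1 s.2 with hUdef
    have hU : IsClopen U := D.isClopen_movable (hW j) h1 h2
    have hUs : U ⊆ s.1 := Set.inter_subset_left.trans Set.inter_subset_left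
    have hm : D.μ s.2 ≤ D.μ (s.2 \ D.iter (-n j) ⁻¹' U) + ENNReal.ofReal ε * D.μ U := by
      refine ((measure_mono (Set.subset_sdiff_union _ _)).trans
        (measure_union_le _ (D.iter (-n j) ⁻¹' U))).trans ?_
      gcongr
      exact D.measure_translate_le hU.isOpen.measurableSet _ fun x hx => hε j x hx.1.2
    have hadd : D.μ (A \ (s.1 \ U)) = D.μ U + D.μ (A \ s.1) := by
      rw [← measure_union ((Set.disjoint_left (s := U) (t := A \ s.1)).2 fun x hx hx' => hx'.2 (hUs hx))
        (hA.isOpen.sdiff h1.isClosed).measurableSet]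
      congr 1
      ext x
      have := @hUs x
      have := @hsub x
      simp only [Set.mem_sdiff, Set.mem_union]
      tauto
    calc D.μ B ≤ _ := ih
      _ ≤ _ := add_le_add_left hm _
      _ = _ := by rw [hadd, mul_add, add_assoc]

end Exhaustion

section Halving

variable [PolishSpace X] {D}

/-- There is a clopen sequence of tasks which exhausts the pairs `(n, x)`, `x ≠ p`, at which the
derivative is less than `ε`. -/
lemma exists_tasks (hzd : ZeroDimensional X) (p : X) (ε : ℝ) :
    ∃ (n : ℕ → ℤ) (W : ℕ → Set X), (∀ j, IsClopen (W j)) ∧ (∀ j, p ∉ W j) ∧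
      (∀ j, ∀ x ∈ W j, D.deriv (n j) x ≤ ε) ∧
      ∀ m x, x ≠ p → D.deriv m x < ε → ∃ j, n j = m ∧ x ∈ W j := by
  classical
  obtain ⟨b, hbc, hbo, hb⟩ := hzd
  have := hbc.to_subtype
  obtain ⟨s, hs, -⟩ := hb.exists_subset_of_mem_open (Set.mem_univ p) isOpen_univ
  have : Nonempty b := ⟨⟨s, hs⟩⟩
  obtain ⟨e, he⟩ := exists_surjective_nat (ℤ × b)
  refine ⟨fun j => (e j).1, fun j =>
    if ((e j).2 : Set X) ⊆ {x | x ≠ p ∧ D.deriv (e j).1 x < ε} then (e j).2 else ∅,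
    fun j => ?_, fun j => ?_, fun j x hx => ?_, fun m x hxp hx => ?_⟩
  · dsimp only
    split_ifs
    · exact hbo _ (e j).2.2
    · exact isClopen_empty
  · dsimp only
    split_ifs with h
    · exact fun hp => (h hp).1 rfl
    · simp
  · dsimp only at hx
    split_ifs at hx with h
    · exact (h hx).2.le
    · exact hx.elim
  · have hopen : IsOpen {x | x ≠ p ∧ D.deriv m x < ε} :=
      isOpen_ne.inter (isOpen_lt (D.continuous_deriv m) continuous_const)
    obtain ⟨t, ht, hxt, hts⟩ := hb.exists_subset_of_mem_open (a := x)
      (u := {x | x ≠ p ∧ D.deriv m x < ε}) ⟨hxp, hx⟩ hopen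
    obtain ⟨j, hj⟩ := he (m, ⟨t, ht⟩)
    refine ⟨j, by simp [hj], ?_⟩
    dsimp only
    rw [if_pos] <;> simpa [hj]

variable [BorelSpace X]

lemma exists_matched_halve_left (hzd : ZeroDimensional X) (hIII : D.TypeIII) {A B : Set X}
    (hA : IsClopen A) (hB : IsClopen B) (hAne : A.Nonempty) (hBne : B.Nonempty) :
    ∃ A' B' : Set X, IsClopen A' ∧ IsClopen B' ∧ A'.Nonempty ∧ B'.Nonempty ∧ A' ⊆ A ∧ B' ⊆ B ∧
      D.μ A' ≤ D.μ A / 2 ∧ D.Matched (A \ A') (B \ B') := by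
  have := D.prob
  have : NullSingletonClass D.μ := D.noAtoms
  obtain ⟨p, hp⟩ := hAne
  have hApos : D.μ A ≠ 0 := (D.fullSupport A hA.isOpen ⟨p, hp⟩).ne'
  have hBpos : D.μ B ≠ 0 := (D.fullSupport B hB.isOpen hBne).ne'
  have hBtop : D.μ B ≠ ⊤ := measure_ne_top _ _
  set ε : ℝ := (D.μ B / 2).toReal 
  have hεB : ENNReal.ofReal ε = D.μ B / 2 :=
    ENNReal.ofReal_toReal (ENNReal.div_ne_top hBtop two_ne_zero)
  have hε : 0 < ε := by
    rw [← ENNReal.ofReal_pos, hεB]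
    exact ENNReal.half_pos hBpos
  obtain ⟨n, W, hW, hpW, hWε, hex⟩ := exists_tasks (D := D) hzd p ε
  set s := D.greedy n W A B
  have hclopen := isClopen_greedy (D := D) (n := n) hW hA hB
  have hBlow : ∀ j, D.μ B / 2 ≤ D.μ (s j).2 := fun j => by
    have h := measure_le_greedy_snd (D := D) hW hA hB hWε j
    have h' : D.μ B / 2 + D.μ B / 2 ≤ D.μ (s j).2 + D.μ B / 2 := by
      rw [ENNReal.add_halves]
      refine h.trans (add_le_add_right ?_ _)
      rw [hεB]
      exact mul_le_of_le_one_right' prob_le_one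
    exact (ENNReal.add_le_add_iff_right (ENNReal.div_ne_top hBtop two_ne_zero)).1 h'
  have hBinf : D.μ (⋂ j, (s j).2) ≠ 0 := by
    refine ((ENNReal.half_pos hBpos).trans_le ?_).ne'
    exact ge_of_tendsto' (tendsto_measure_iInter_atTop
      (fun j => (hclopen j).2.isOpen.measurableSet.nullMeasurableSet) greedy_snd_antitone
      ⟨0, measure_ne_top _ _⟩) hBlow
  have hAinf : D.μ (⋂ j, (s j).1) = 0 := by
    by_contra h0
    have h0' : D.μ ((⋂ j, (s j).1) \ {p}) ≠ 0 := by
      rwa [measure_sdiff_null (measure_singleton p)]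
    obtain ⟨m, x, hx, hmx, hlt⟩ := D.exists_deriv_lt hIII
      (MeasurableSet.iInter fun j => (hclopen j).2.isOpen.measurableSet) h0' hBinf hε
    obtain ⟨j, rfl, hxW⟩ := hex m x hx.2 hlt
    obtain ⟨i, hi⟩ := not_mem_greedy (Set.mem_iInter.1 hx.1) hxW
    exact hi (Set.mem_iInter.1 hmx i)
  have hlim := tendsto_measure_iInter_atTop (μ := D.μ) (s := fun j => (s j).1)
    (fun j => (hclopen j).1.isOpen.measurableSet.nullMeasurableSet) greedy_fst_antitone
    ⟨0, measure_ne_top _ _⟩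
  rw [hAinf] at hlim
  obtain ⟨j, hj⟩ := (hlim.eventually_lt_const (ENNReal.half_pos hApos)).exists
  exact ⟨(s j).1, (s j).2, (hclopen j).1, (hclopen j).2, ⟨p, mem_greedy_fst hp hpW j⟩,
    nonempty_of_measure_ne_zero ((ENNReal.half_pos hBpos).trans_le (hBlow j)).ne',
    greedy_fst_antitone j.zero_le, greedy_snd_antitone j.zero_le, hj.le,
    matched_greedy hW hA hB j⟩

lemma exists_matched_halve (hzd : ZeroDimensional X) (hIII : D.TypeIII) {A B : Set X}
    (hA : IsClopen A) (hB : IsClopen B) (hAne : A.Nonempty) (hBne : B.Nonempty) :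
    ∃ A' B' : Set X, IsClopen A' ∧ IsClopen B' ∧ A'.Nonempty ∧ B'.Nonempty ∧ A' ⊆ A ∧ B' ⊆ B ∧
      D.μ A' ≤ D.μ A / 2 ∧ D.μ B' ≤ D.μ B / 2 ∧ D.Matched (A \ A') (B \ B') := by
  obtain ⟨A₁, B₁, hA₁, hB₁, hA₁ne, hB₁ne, hA₁A, hB₁B, hμA, hm₁⟩ :=
    exists_matched_halve_left hzd hIII hA hB hAne hBne
  obtain ⟨B₂, A₂, hB₂, hA₂, hB₂ne, hA₂ne, hB₂B, hA₂A, hμB, hm₂⟩ :=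
    exists_matched_halve_left hzd hIII hB₁ hA₁ hB₁ne hA₁ne
  exact ⟨A₂, B₂, hA₂, hB₂, hA₂ne, hB₂ne, hA₂A.trans hA₁A, hB₂B.trans hB₁B,
    (measure_mono hA₂A).trans hμA, hμB.trans (by gcongr),
    hm₁.trans_diff hA₁A hA₂A hB₁B hB₂B hm₂.symm⟩

end Halving

end DynSys

lemma pairwise_disjoint_diff_succ {α : Type*} {s : ℕ → Set α} (hs : Antitone s) :
    Pairwise (Function.onFun Disjoint fun k => s k \ s (k + 1)) := by
  refine (pairwise_disjoint_on _).2 fun k l hkl => Set.disjoint_left.2 fun x hx hx' => ?_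
  exact hx.2 (hs (Nat.succ_le_of_lt hkl) hx'.1)

lemma measure_diff_iUnion_diff_succ {X : Type*} [MeasurableSpace X] {μ : Measure X}
    [IsFiniteMeasure μ] {s : ℕ → Set X} (hhalf : ∀ k, μ (s (k + 1)) ≤ μ (s k) / 2) :
    μ (s 0 \ ⋃ k, (s k \ s (k + 1))) = 0 := by
  have hmem : ∀ k, s 0 \ ⋃ k, (s k \ s (k + 1)) ⊆ s k := fun k x hx => by
    induction k with
    | zero => exact hx.1
    | succ k ih =>
      by_contra hk
      exact hx.2 (Set.mem_iUnion.2 ⟨k, ih, hk⟩)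
  have hle : ∀ k, μ (s k) ≤ μ (s 0) * 2⁻¹ ^ k := fun k => by
    induction k with
    | zero => simp
    | succ k ih =>
      refine (hhalf k).trans ?_
      rw [pow_succ, ← mul_assoc, ENNReal.div_eq_inv_mul, mul_comm]
      gcongr
  have hlim : Filter.Tendsto (fun k : ℕ => μ (s 0) * (2⁻¹ : ENNReal) ^ k) Filter.atTop (𝓝 0) := by
    simpa using ENNReal.Tendsto.const_mul
      (ENNReal.tendsto_pow_atTop_nhds_zero_of_lt_one ENNReal.one_half_lt_one)
      (Or.inr (measure_ne_top μ (s 0)))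
  exact le_antisymm (ge_of_tendsto' hlim fun k => (measure_mono (hmem k)).trans (hle k)) bot_le

/-- **Lemma 1.4(ii).** If `T` is of type `III` and `A`, `B` are non-empty clopen sets,
then there is a homeomorphism `S : A' → B'` in the topological full groupoid
`[[T]]_top` between open full-measure subsets `A' ⊆ A`, `B' ⊆ B`. -/
theorem exists_full_groupoid_homeo_typeIII {X : Type*}
    [TopologicalSpace X] [PolishSpace X] [MeasurableSpace X] [BorelSpace X]
    (D : DynSys X) (hzd : ZeroDimensional X) (hIII : D.TypeIII)
    (A B : Set X) (hA : IsClopen A) (hB : IsClopen B)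
    (hAne : A.Nonempty) (hBne : B.Nonempty) :
    ∃ (A' B' : Set X) (S S' : X → X) (a : X → ℤ),
      IsOpen A' ∧ A' ⊆ A ∧ IsOpen B' ∧ B' ⊆ B ∧
      D.μ (A \ A') = 0 ∧ D.μ (B \ B') = 0 ∧
      Set.BijOn S A' B' ∧ ContinuousOn S A' ∧ ContinuousOn S' B' ∧
      Set.InvOn S' S A' B' ∧
      ContinuousOn a A' ∧ (∀ x ∈ A', S x = D.iter (a x) x) := by
  have := D.prob
  let State := {q : Set X × Set X // IsClopen q.1 ∧ IsClopen q.2 ∧ q.1.Nonempty ∧ q.2.Nonempty}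
  have hstep : ∀ q : State, ∃ r : State, r.1.1 ⊆ q.1.1 ∧ r.1.2 ⊆ q.1.2 ∧
      D.μ r.1.1 ≤ D.μ q.1.1 / 2 ∧ D.μ r.1.2 ≤ D.μ q.1.2 / 2 ∧
      D.Matched (q.1.1 \ r.1.1) (q.1.2 \ r.1.2) := by
    rintro ⟨q, h1, h2, h3, h4⟩
    obtain ⟨A', B', hA', hB', hA'ne, hB'ne, h⟩ :=
      DynSys.exists_matched_halve hzd hIII h1 h2 h3 h4
    exact ⟨⟨(A', B'), hA', hB', hA'ne, hB'ne⟩, h⟩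
  choose succState hnextA hnextB hhalfA hhalfB hmatch using hstep
  let s : ℕ → State := fun k => succState^[k] ⟨(A, B), hA, hB, hAne, hBne⟩
  have hs : ∀ k, s (k + 1) = succState (s k) := fun k => Function.iterate_succ_apply' _ _ _
  have hantiA : Antitone fun k => (s k).1.1 :=
    antitone_nat_of_succ_le fun k => (hs k).symm ▸ hnextA (s k)
  have hantiB : Antitone fun k => (s k).1.2 :=
    antitone_nat_of_succ_le fun k => (hs k).symm ▸ hnextB (s k)
  have hm : D.Matched (⋃ k, ((s k).1.1 \ (s (k + 1)).1.1)) (⋃ k, ((s k).1.2 \ (s (k + 1)).1.2)) :=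
    .iUnion (fun k => (hs k).symm ▸ hmatch (s k))
      (pairwise_disjoint_diff_succ hantiA) (pairwise_disjoint_diff_succ hantiB)
  obtain ⟨S, S', a, hS⟩ := hm.exists_homeo
  exact ⟨_, _, S, S', a, hm.isOpen,
    Set.iUnion_subset fun k => Set.sdiff_subset.trans (hantiA k.zero_le), hm.symm.isOpen,
    Set.iUnion_subset fun k => Set.sdiff_subset.trans (hantiB k.zero_le),
    measure_diff_iUnion_diff_succ fun k => (hs k).symm ▸ hhalfA (s k),
    measure_diff_iUnion_diff_succ fun k => (hs k).symm ▸ hhalfB (s k), hS⟩
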